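/- Let (A_1,…,A_t) be a nomincreasing ordered set partition of {1,…,n}, let x_j = min A_j and a_j = |A_j|, suppose exactly ℓ of the blocks have size greater than 1, exactly s of the blocks have size 1, and the last block A_t has size greater than 1. Then the word U^{a_1} D^{x_2−x_1} U^{a_2} D^{x_3−x_2} ⋯ U^{a_{t−1}} D^{x_t−x_{t−1}} U^{a_t} D^{n−x_t+x_1} is a Dyck path of semilength n, and moreover it belongs to Dyck(n,ℓ,s): it has exactly ℓ long ascents, exactly s singletons, and no singleton after its last long ascent. -/

import Mathlib

/-! ## Skew Young tableaux -/

/-- Cells (row, col), 0-indexed, of the skew diagram with `b-2` single cells in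
column `i` on top, two full rows of length `i+1`, and `a-2` single cells in column `0` below. -/
def skytCells (a i b : ℕ) : Finset (ℕ × ℕ) :=
  (Finset.range (a + b - 2) ×ˢ Finset.range (i + 1)).filter fun c =>
    (c.1 + 2 < b → c.2 = i) ∧ (b ≤ c.1 → c.2 = 0)

/-- Skew standard Young tableaux of shape `[(i+1)^b, 1^(a-2)] / [(i-1)^(b-2)]`,
modelled as fillings of `skytCells a i b` by `1, …, a+b+2i-2`, increasing along
rows and columns, and vanishing outside the diagram. -/
def SkytSet (a i b : ℕ) : Set ((ℕ × ℕ) → ℕ) :=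
  {f | (∀ c, c ∉ skytCells a i b → f c = 0) ∧
    Set.BijOn f (skytCells a i b : Set (ℕ × ℕ)) (Finset.Icc 1 (a + b + 2 * i - 2) : Set ℕ) ∧
    (∀ c ∈ skytCells a i b, ∀ d ∈ skytCells a i b, c.1 = d.1 → c.2 < d.2 → f c < f d) ∧
    (∀ c ∈ skytCells a i b, ∀ d ∈ skytCells a i b, c.2 = d.2 → c.1 < d.1 → f c < f d)}

/-! ## Dyck paths -/

/-- Lengths of the maximal ascents (runs of `true`) of a word. -/
def ascentLengths (w : List Bool) : List ℕ :=
  ((w.splitBy (· == ·)).filter fun r => r.headD false).map List.length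

/-- `DyckSet n l s`: Dyck paths (`true` = up-step) of semilength `n` with exactly `l`
long ascents, exactly `s` singletons, and no singleton after the last long ascent. -/
def DyckSet (n l s : ℕ) : Set (List Bool) :=
  {w | w.length = 2 * n ∧ w.count true = w.count false ∧
    (∀ p, p <+: w → p.count false ≤ p.count true) ∧
    ((ascentLengths w).filter fun x => decide (2 ≤ x)).length = l ∧
    ((ascentLengths w).filter fun x => decide (x = 1)).length = s ∧
    ∀ j, (ascentLengths w).getD j 0 = 1 → ∃ k, j < k ∧ 2 ≤ (ascentLengths w).getD k 0}

/-! ## Dissections and triangulations -/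

/-- A chord of the convex `n`-gon (vertices `1, …, n` counterclockwise): a pair of
non-adjacent vertices, recorded with the smaller endpoint first. -/
def IsChord (n : ℕ) (c : ℕ × ℕ) : Prop :=
  1 ≤ c.1 ∧ c.1 + 1 < c.2 ∧ c.2 ≤ n ∧ ¬(c.1 = 1 ∧ c.2 = n)

/-- Two chords cross in the interior of the polygon. -/
def Crosses (c d : ℕ × ℕ) : Prop :=
  (c.1 < d.1 ∧ d.1 < c.2 ∧ c.2 < d.2) ∨ (d.1 < c.1 ∧ c.1 < d.2 ∧ d.2 < c.2)

/-- A dissection of the `n`-gon: a set of pairwise non-crossing chords. -/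
def IsDissection (n : ℕ) (S : Finset (ℕ × ℕ)) : Prop :=
  (∀ c ∈ S, IsChord n c) ∧ (∀ c ∈ S, ∀ d ∈ S, c ≠ d → ¬Crosses c d)

/-- `DisSet n k`: dissections of the `n`-gon with exactly `k` chords. -/
def DisSet (n k : ℕ) : Set (Finset (ℕ × ℕ)) :=
  {S | IsDissection n S ∧ S.card = k}

/-- A triangulation of the `n`-gon: a maximal set of pairwise non-crossing chords. -/
def IsTriangulation (n : ℕ) (S : Finset (ℕ × ℕ)) : Prop :=
  IsDissection n S ∧ ∀ c, IsChord n c → (∀ d ∈ S, ¬Crosses c d) → c ∈ S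

/-- Fuelled recursive computation of the fan decomposition of the triangulation induced by
the chord set `S` on the vertex interval `[p, r]`: returns the list of pairs
(origin of fan, number of triangles of the fan), in the order of the recursive
fan decomposition (fan at the smallest vertex first, then the decompositions of the
sub-polygons in counterclockwise order). -/
def fanListAux (S : Finset (ℕ × ℕ)) : ℕ → ℕ → ℕ → List (ℕ × ℕ)
  | 0, _, _ => []
  | fuel + 1, p, r =>
    if r ≤ p + 1 then []
    else
      let ws := ((S.filter fun c => c.1 = p ∧ p + 1 < c.2 ∧ c.2 < r).image Prod.snd).sort (· ≤ ·)
      let link := (p + 1) :: (ws ++ [r])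
      (p, ws.length + 1) :: (link.zip link.tail).flatMap fun q => fanListAux S fuel q.1 q.2

/-- The fan decomposition `F(T)` of the triangulation `S` of the polygon on the vertex
interval `[p, r]`, as a list of (origin, fan size) pairs. -/
def fanList (S : Finset (ℕ × ℕ)) (p r : ℕ) : List (ℕ × ℕ) :=
  fanListAux S (r - p) p r

/-- The sequence `δ(T) = (d_1, …, d_{k-1})` of differences of consecutive fan origins. -/
def deltaList (L : List (ℕ × ℕ)) : List ℕ :=
  ((L.map Prod.fst).zip (L.map Prod.fst).tail).map fun q => q.2 - q.1

/-- `TriSet n t s`: triangulations of the `n`-gon whose fan decomposition has `t + s` fans,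
exactly `s` of them singular, the last one not singular. -/
def TriSet (n t s : ℕ) : Set (Finset (ℕ × ℕ)) :=
  {S | IsTriangulation n S ∧
    (fanList S 1 n).length = t + s ∧
    ((fanList S 1 n).filter fun fan => decide (fan.2 = 1)).length = s ∧
    ((fanList S 1 n).getLastD (0, 0)).2 ≠ 1}

/-! ## Ordered set partitions -/

/-- The minimum of a finite set of naturals (0 by convention for `∅`). -/
def blockMin (A : Finset ℕ) : ℕ := (A.sort (· ≤ ·)).getD 0 0

/-- The second-smallest element of a finite set of naturals. -/
def blockSndMin (A : Finset ℕ) : ℕ := (A.sort (· ≤ ·)).getD 1 0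

/-- An ordered set partition of `{1, …, n}` : a list of nonempty pairwise disjoint
blocks whose union is `{1, …, n}`. -/
def IsOSP (n : ℕ) (L : List (Finset ℕ)) : Prop :=
  (∀ A ∈ L, A.Nonempty) ∧ List.Pairwise Disjoint L ∧
    L.foldr (· ∪ ·) ∅ = Finset.Icc 1 n

/-- Nomincreasing: the blocks' minima strictly increase, and the second-smallest elements
of the blocks of size at least 2 strictly increase (in the order the blocks appear). -/
def Nomincreasing (L : List (Finset ℕ)) : Prop :=
  (L.map blockMin).Chain' (· < ·) ∧
    ((L.filter fun A => decide (2 ≤ A.card)).map blockSndMin).Chain' (· < ·)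

/-- The word `U^{a_1} D^{x_2-x_1} ⋯ U^{a_t} D^{n-x_t+x_1}` attached to an ordered set
partition of `{1, …, n}` with minima `x_j` and block sizes `a_j`. -/
def ospWord (n : ℕ) (L : List (Finset ℕ)) : List Bool :=
  let xs := L.map blockMin
  let ds := ((xs.zip xs.tail).map fun q => q.2 - q.1) ++ [n - xs.getLastD 0 + xs.headD 0]
  ((L.map Finset.card).zip ds).flatMap fun q =>
    List.replicate q.1 true ++ List.replicate q.2 false

/-! ## The map `Nom` -/

/-- The `j`-th block (0-indexed) of `Nom(λ)` for a tableau `f ∈ SkytSet a i b`. -/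
def nomBlock (a i b : ℕ) (f : ℕ × ℕ → ℕ) (j : ℕ) : Finset ℕ :=
  let N := a + b + 2 * i - 2
  let X := ((skytCells a i b).filter fun c => c.1 + 1 < b).image f
  let x := (X.sort (· ≤ ·)).getD j 0
  let row := (Finset.range (i + 1)).filter fun c => f (b - 2, c) = x
  if row.Nonempty then
    let col := (row.sort (· ≤ ·)).getD 0 0
    if col = i then insert x (Finset.Icc (f (b - 1, col)) N \ X)
    else insert x (Finset.Icc (f (b - 1, col)) (f (b - 1, col + 1) - 1) \ X)
  else {x}

/-- The nomincreasing ordered set partition `Nom(λ)` of a tableau `λ ∈ SkytSet a i b`. -/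
def Nom (a i b : ℕ) (f : ℕ × ℕ → ℕ) : List (Finset ℕ) :=
  (List.range (i + b - 1)).map (nomBlock a i b f)

/-- The Dyck word `U^{u_1} D^{d_1} ⋯ U^{u_{t+s}} D^{d_{t+s}}` attached to a triangulation. -/
def triWord (n : ℕ) (S : Finset (ℕ × ℕ)) : List Bool :=
  let L := fanList S 1 n
  let xs := L.map Prod.fst
  let ds := deltaList L ++ [n - xs.getLastD 0 + xs.headD 0 - 2]
  ((L.map Prod.snd).zip ds).flatMap fun q =>
    List.replicate q.1 true ++ List.replicate q.2 false

/-- The word `U^{a_1} D^{x_2-x_1} ⋯ U^{a_t} D^{e-x_t}` attached to the pairs `(x_j, a_j)`. -/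
def stepWord (e : ℕ) : List (ℕ × ℕ) → List Bool
  | [] => []
  | q :: ps => List.replicate q.2 true ++
      (List.replicate ((ps.map Prod.fst).headD e - q.1) false ++ stepWord e ps)

theorem lt_headD_of_isChain {e : ℕ} {q : ℕ × ℕ} {ps : List (ℕ × ℕ)}
    (h : ((q :: ps).map Prod.fst ++ [e]).IsChain (· < ·)) :
    q.1 < (ps.map Prod.fst).headD e := by
  cases ps with
  | nil => simpa using h
  | cons r ps => exact (List.isChain_cons_cons.1 h).1

theorem count_true_stepWord (e : ℕ) (ps : List (ℕ × ℕ)) :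
    (stepWord e ps).count true = (ps.map Prod.snd).sum := by
  induction ps with
  | nil => rfl
  | cons q ps ih => simp [stepWord, List.count_append, List.count_replicate, ih]

theorem headD_add_count_false_stepWord {e : ℕ} {ps : List (ℕ × ℕ)}
    (h : (ps.map Prod.fst ++ [e]).IsChain (· < ·)) :
    (ps.map Prod.fst).headD e + (stepWord e ps).count false = e := by
  induction ps with
  | nil => simp [stepWord]
  | cons q ps ih =>
    have ih := ih h.tail
    have hlt := lt_headD_of_isChain h
    simp only [stepWord, List.count_append, List.count_replicate, List.map_cons, List.headD_cons]
    simp [-List.headD_eq_head?_getD]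
    omega

theorem head?_stepWord_eq_true {e : ℕ} {ps : List (ℕ × ℕ)} (hpos : ∀ q ∈ ps, 0 < q.2) :
    ∀ y ∈ (stepWord e ps).head?, y = true := by
  cases ps with
  | nil => simp [stepWord]
  | cons q ps =>
    obtain ⟨m, hm⟩ := Nat.exists_eq_succ_of_ne_zero (hpos q (by simp)).ne'
    simp [stepWord, hm, List.replicate_succ]

theorem splitBy_replicate_append {b : Bool} {m : ℕ} (hm : 0 < m) {w : List Bool}
    (hw : ∀ y ∈ w.head?, y ≠ b) :
    (List.replicate m b ++ w).splitBy (· == ·) =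
      List.replicate m b :: w.splitBy (· == ·) := by
  rw [List.splitBy_append, List.splitBy_of_isChain]
  · rfl
  · simpa using hm.ne'
  · exact List.isChain_replicate_of_rel m (by simp)
  · intro x hx y hy
    have hxb := List.eq_of_mem_replicate (List.mem_of_mem_getLast? hx)
    subst hxb
    simpa using (hw y hy).symm

theorem ascentLengths_stepWord {e : ℕ} {ps : List (ℕ × ℕ)}
    (h : (ps.map Prod.fst ++ [e]).IsChain (· < ·)) (hpos : ∀ q ∈ ps, 0 < q.2) :
    ascentLengths (stepWord e ps) = ps.map Prod.snd := by
  induction ps with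
  | nil => rfl
  | cons q ps ih =>
    have hpos' : ∀ q ∈ ps, 0 < q.2 := fun r hr => hpos r (List.mem_cons_of_mem _ hr)
    have ih := ih h.tail hpos'
    have hlt : 0 < (ps.map Prod.fst).headD e - q.1 := Nat.sub_pos_of_lt (lt_headD_of_isChain h)
    have hq := hpos q (by simp)
    unfold ascentLengths at ih ⊢
    rw [stepWord, splitBy_replicate_append hq, splitBy_replicate_append hlt]
    · obtain ⟨m, hm⟩ := Nat.exists_eq_succ_of_ne_zero hq.ne'
      obtain ⟨k, hk⟩ := Nat.exists_eq_succ_of_ne_zero hlt.ne'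
      rw [hk, List.filter_cons_of_pos (by simp [hm, List.replicate_succ]),
        List.filter_cons_of_neg (by simp [List.replicate_succ])]
      simp [ih, -List.headD_eq_head?_getD]
    · intro y hy
      simp [head?_stepWord_eq_true hpos' y hy]
    · obtain ⟨k, hk⟩ := Nat.exists_eq_succ_of_ne_zero hlt.ne'
      simp [hk, List.replicate_succ, -List.headD_eq_head?_getD]

theorem prefix_append_cases {α : Type*} {p l m : List α} (h : p <+: l ++ m) :
    p <+: l ∨ ∃ t, t <+: m ∧ p = l ++ t := by
  obtain ⟨r, hr⟩ := h
  rcases List.append_eq_append_iff.1 hr with ⟨a, ha, -⟩ | ⟨a, ha, hb⟩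
  · exact Or.inl ⟨a, ha.symm⟩
  · exact Or.inr ⟨a, ⟨r, hb.symm⟩, ha⟩

theorem count_false_le_of_prefix_stepWord {e c : ℕ} {ps : List (ℕ × ℕ)}
    (h : (ps.map Prod.fst ++ [e]).IsChain (· < ·))
    (hx : ∀ L₁ q L₂, ps = L₁ ++ q :: L₂ → q.1 ≤ c + (L₁.map Prod.snd).sum)
    (he : e ≤ c + (ps.map Prod.snd).sum) {p : List Bool} (hp : p <+: stepWord e ps) :
    (ps.map Prod.fst).headD e + p.count false ≤ c + p.count true := by
  induction ps generalizing c p with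
  | nil =>
    rw [stepWord, List.prefix_nil] at hp
    simpa [hp] using he
  | cons q ps ih =>
    have hq : q.1 ≤ c := by simpa using hx [] q ps rfl
    have ih' : ∀ {t}, t <+: stepWord e ps →
        (ps.map Prod.fst).headD e + t.count false ≤ c + q.2 + t.count true := fun ht =>
      ih h.tail (fun L₁ r L₂ hr => by
          have := hx (q :: L₁) r L₂ (by simp [hr])
          simpa [add_assoc] using this)
        (by simpa [add_assoc] using he) ht
    have hlt := lt_headD_of_isChain h
    have hnext : (ps.map Prod.fst).headD e ≤ c + q.2 := by
      simpa using ih' List.nil_prefix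
    simp only [List.map_cons, List.headD_cons]
    rcases prefix_append_cases hp with hp | ⟨t, ht, rfl⟩
    · rw [(List.prefix_replicate_iff.1 hp).2]
      simp [List.count_replicate]
      omega
    rcases prefix_append_cases ht with ht | ⟨u, hu, rfl⟩
    · have hle := (List.prefix_replicate_iff.1 ht).1
      rw [(List.prefix_replicate_iff.1 ht).2]
      simp [List.count_append, List.count_replicate, -List.headD_eq_head?_getD]
      omega
    · have := ih' hu
      simp [List.count_append, List.count_replicate, -List.headD_eq_head?_getD]
      omega

theorem ospWord_eq_stepWord {n : ℕ} {L : List (Finset ℕ)} {e : ℕ}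
    (he : n - (L.map blockMin).getLastD 0 + (L.map blockMin).headD 0 =
      e - (L.map blockMin).getLastD 0) :
    ospWord n L = stepWord e (L.map fun A => (blockMin A, A.card)) := by
  unfold ospWord
  simp only [he]
  clear he
  induction L with
  | nil => rfl
  | cons A L ih =>
    cases L with
    | nil => simp [stepWord]
    | cons B L => simpa [stepWord] using ih

theorem blockMin_mem {A : Finset ℕ} (hA : A.Nonempty) : blockMin A ∈ A := by
  have h : 0 < A.sort.length := by simpa using hA.card_pos
  unfold blockMin
  rw [List.getD_eq_getElem _ _ h]
  exact (Finset.mem_sort _).1 (List.getElem_mem h)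

theorem blockMin_le {A : Finset ℕ} {x : ℕ} (hx : x ∈ A) : blockMin A ≤ x := by
  have h : 0 < A.sort.length := by simpa using Finset.card_pos.2 ⟨x, hx⟩
  unfold blockMin
  rw [List.getD_eq_getElem _ _ h, Finset.sorted_zero_eq_min']
  exact Finset.min'_le _ _ hx

theorem mem_foldr_union {L : List (Finset ℕ)} {x : ℕ} :
    x ∈ L.foldr (· ∪ ·) ∅ ↔ ∃ A ∈ L, x ∈ A := by
  induction L with
  | nil => simp
  | cons A L ih => simp [ih]

theorem card_foldr_union_le (L : List (Finset ℕ)) :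
    (L.foldr (· ∪ ·) ∅).card ≤ (L.map Finset.card).sum := by
  induction L with
  | nil => simp
  | cons A L ih =>
    simpa using (Finset.card_union_le _ _).trans (Nat.add_le_add_left ih _)

theorem card_foldr_union {L : List (Finset ℕ)} (h : L.Pairwise Disjoint) :
    (L.foldr (· ∪ ·) ∅).card = (L.map Finset.card).sum := by
  induction L with
  | nil => simp
  | cons A L ih =>
    rw [List.pairwise_cons] at h
    have hd : Disjoint A (L.foldr (· ∪ ·) ∅) := by
      rw [Finset.disjoint_left]
      intro x hxA hx
      obtain ⟨B, hB, hxB⟩ := mem_foldr_union.1 hx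
      exact Finset.disjoint_left.1 (h.1 B hB) hxA hxB
    simp only [List.foldr_cons, List.map_cons, List.sum_cons]
    rw [Finset.card_union_of_disjoint hd, ih h.2]

/-- All elements below the minimum of a block lie in earlier blocks. -/
theorem blockMin_le_one_add_sum_card {n : ℕ} {L₁ L₂ : List (Finset ℕ)} {B : Finset ℕ}
    (hosp : IsOSP n (L₁ ++ B :: L₂))
    (hmin : ((L₁ ++ B :: L₂).map blockMin).Pairwise (· < ·)) :
    blockMin B ≤ 1 + (L₁.map Finset.card).sum := by
  obtain ⟨hne, -, hun⟩ := hosp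
  have hB : blockMin B ∈ Finset.Icc 1 n :=
    hun ▸ mem_foldr_union.2 ⟨B, by simp, blockMin_mem (hne B (by simp))⟩
  have hsub : Finset.Icc 1 (blockMin B - 1) ⊆ L₁.foldr (· ∪ ·) ∅ := by
    intro x hx
    rw [Finset.mem_Icc] at hx hB
    have hxn : x ∈ (L₁ ++ B :: L₂).foldr (· ∪ ·) ∅ := by
      rw [hun, Finset.mem_Icc]
      omega
    obtain ⟨C, hC, hxC⟩ := mem_foldr_union.1 hxn
    have hCx := blockMin_le hxC
    rw [List.map_append, List.map_cons, List.pairwise_append, List.pairwise_cons] at hmin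
    rcases List.mem_append.1 hC with hC | hC
    · exact mem_foldr_union.2 ⟨C, hC, hxC⟩
    rcases List.mem_cons.1 hC with rfl | hC
    · omega
    · have := hmin.2.1.1 _ (List.mem_map_of_mem hC)
      omega
  have := (Finset.card_le_card hsub).trans (card_foldr_union_le L₁)
  rw [Nat.card_Icc] at this
  omega

/-- The word attached to a nomincreasing ordered set partition of `{1, …, n}` with
exactly `l` blocks of size `> 1`, exactly `s` blocks of size `1`, and last block of
size `> 1`, is a Dyck path of semilength `n` belonging to `Dyck(n, l, s)`. -/
theorem ospWord_mem_dyckSet (n l s : ℕ) (L : List (Finset ℕ))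
    (hosp : IsOSP n L) (hnom : Nomincreasing L)
    (hl : (L.filter fun A => decide (2 ≤ A.card)).length = l)
    (hs : (L.filter fun A => decide (A.card = 1)).length = s)
    (hlast : 1 < (L.getLastD ∅).card) :
    ospWord n L ∈ DyckSet n l s := by
  have hL : L ≠ [] := by
    rintro rfl
    simp at hlast
  obtain ⟨hne, hdisj, hun⟩ := id hosp
  have hmin : (L.map blockMin).Pairwise (· < ·) := List.isChain_iff_pairwise.1 hnom.1
  have hrange : ∀ A ∈ L, 1 ≤ blockMin A ∧ blockMin A ≤ n := fun A hA =>
    Finset.mem_Icc.1 (hun ▸ mem_foldr_union.2 ⟨A, hA, blockMin_mem (hne A hA)⟩)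
  have hhead : (L.map blockMin).headD 0 = 1 := by
    obtain ⟨A, L', rfl⟩ := List.exists_cons_of_ne_nil hL
    have h₁ := blockMin_le_one_add_sum_card (L₁ := []) hosp hmin
    have h₂ := (hrange A (by simp)).1
    simp at h₁ ⊢
    omega
  have hlastle : (L.map blockMin).getLastD 0 ≤ n := by
    rw [List.getLastD_eq_getLast?, List.getLast?_map, List.getLast?_eq_getLast_of_ne_nil hL]
    exact (hrange _ (List.getLast_mem hL)).2
  have hcard : (L.map Finset.card).sum = n := by
    rw [← card_foldr_union hdisj, hun, Nat.card_Icc, Nat.add_sub_cancel]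
  set ps := L.map fun A => (blockMin A, A.card) with hps
  have hfst : ps.map Prod.fst = L.map blockMin := by simp [hps, Function.comp_def]
  have hsnd : ps.map Prod.snd = L.map Finset.card := by simp [hps, Function.comp_def]
  have hheadps : (ps.map Prod.fst).headD (n + 1) = 1 := by
    rw [hfst, ← hhead]
    obtain ⟨A, L', rfl⟩ := List.exists_cons_of_ne_nil hL
    rfl
  have hchain : (ps.map Prod.fst ++ [n + 1]).IsChain (· < ·) := by
    rw [hfst, List.isChain_iff_pairwise, List.pairwise_append]
    refine ⟨hmin, List.pairwise_singleton _ _, fun a ha b hb => ?_⟩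
    obtain ⟨A, hA, rfl⟩ := List.mem_map.1 ha
    have := (hrange A hA).2
    rw [List.mem_singleton] at hb
    omega
  have hpos : ∀ q ∈ ps, 0 < q.2 := by
    intro q hq
    obtain ⟨A, hA, rfl⟩ := List.mem_map.1 hq
    exact (hne A hA).card_pos
  have htrue := count_true_stepWord (n + 1) ps
  have hfalse := headD_add_count_false_stepWord hchain
  have hasc := ascentLengths_stepWord hchain hpos
  rw [hsnd, hcard] at htrue
  rw [hheadps] at hfalse
  rw [ospWord_eq_stepWord (e := n + 1) (by omega), ← hps]
  refine ⟨?_, by omega, fun p hp => ?_, ?_, ?_, ?_⟩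
  · rw [← List.count_true_add_count_false]
    omega
  · have := count_false_le_of_prefix_stepWord (c := 1) hchain (fun L₁ q L₂ h => ?_)
      (by rw [hsnd, hcard, add_comm]) hp
    · rw [hheadps] at this
      omega
    · obtain ⟨M₁, M, rfl, rfl, hM⟩ := List.map_eq_append_iff.1 (hps ▸ h)
      obtain ⟨B, M₂, rfl, rfl, rfl⟩ := List.map_eq_cons_iff.1 hM
      simpa [Function.comp_def] using blockMin_le_one_add_sum_card hosp hmin
  · rw [hasc, hsnd, List.filter_map, List.length_map, ← hl]
    rfl
  · rw [hasc, hsnd, List.filter_map, List.length_map, ← hs]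
    rfl
  · intro j hj
    rw [hasc, hsnd] at hj ⊢
    have hlen := List.length_pos_iff.2 hL
    have hlast' : 2 ≤ (L.map Finset.card).getD (L.length - 1) 0 := by
      rw [List.getLastD_eq_getLast?, List.getLast?_eq_getElem?] at hlast
      rw [List.getD_eq_getElem?_getD, List.getElem?_map]
      rw [List.getElem?_eq_getElem (by omega)] at hlast ⊢
      exact hlast
    refine ⟨L.length - 1, ?_, hlast'⟩
    have hjlt : j < (L.map Finset.card).length := by
      by_contra! hge
      rw [List.getD_eq_default _ _ hge] at hj
      omega
    rw [List.length_map] at hjlt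
    have hjne : j ≠ L.length - 1 := by
      rintro rfl
      omega
    omega
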